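/- arXiv:2101.09482 — 2 statements merged into one kernel-verified Lean document; each statement's English description precedes it below -/
import Mathlib

section
/- Let (Ω, F, P) be a probability space and let X, X̄ : [0,∞) × Ω → ℝ^d be jointly measurable stochastic processes. Let α ∈ (0,1), K ≥ 0, and let A : ℝ^d → ℝ satisfy |A(x) − A(y)| ≤ K · |x − y|^α · (1 + |x| + |y|)^{2−α} for all x, y ∈ ℝ^d. Let m ∈ ℝ, and for a moderate scale function a set l_t^A := (1/a(t)) ∫₀ᵗ (A(X_s) − m) ds and l̄_t^A := (1/a(t)) ∫₀ᵗ (A(X̄_s) − m) ds. Let I : ℝ → [0,∞] be a good rate function. Assume: (i) for every moderate scale function a and every closed set F ⊆ ℝ, limsup_{t→∞} (t / a(t)²) · log P(l̄_t^A ∈ F) ≤ − inf_{y∈F} I(y); (ii) there exists δ > 0 such that E[ exp( δ ∫₀^∞ |X_s − X̄_s|^α (1 + |X_s| + |X̄_s|)^{2−α} ds ) ] < ∞. Then for every moderate scale function a and every closed set F ⊆ ℝ, limsup_{t→∞} (t / a(t)²) · log P(l_t^A ∈ F) ≤ − inf_{y∈F} I(y). -/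
open Filter MeasureTheory Topology

/-- A moderate scale function: positive on `(0,∞)`, with `√t / a t → 0` and `a t / t → 0`
as `t → ∞`. -/
def ModerateScale (a : ℝ → ℝ) : Prop :=
  (∀ t > 0, 0 < a t) ∧
    Tendsto (fun t => Real.sqrt t / a t) atTop (𝓝 0) ∧
    Tendsto (fun t => a t / t) atTop (𝓝 0)

/-- A locally Hölder function with polynomially growing constant is continuous. -/
lemma continuous_of_abs_sub_le_rpow {E : Type*} [NormedAddCommGroup E] {A : E → ℝ} {α K : ℝ}
    (hα : 0 < α)
    (hA : ∀ x y : E, |A x - A y| ≤ K * ‖x - y‖ ^ α * (1 + ‖x‖ + ‖y‖) ^ (2 - α)) :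
    Continuous A := by
  refine continuous_iff_continuousAt.2 fun x => ?_
  rw [ContinuousAt, tendsto_iff_norm_sub_tendsto_zero]
  have hcont : ContinuousAt (fun y : E => K * ‖y - x‖ ^ α * (1 + ‖y‖ + ‖x‖) ^ (2 - α)) x := by
    refine ContinuousAt.mul (continuousAt_const.mul ?_) ?_
    · exact ContinuousAt.rpow_const (by fun_prop) (Or.inr hα.le)
    · exact ContinuousAt.rpow_const (by fun_prop) (Or.inl (by positivity))
  have hlim : Tendsto (fun y : E => K * ‖y - x‖ ^ α * (1 + ‖y‖ + ‖x‖) ^ (2 - α)) (𝓝 x) (𝓝 0) := by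
    have h := hcont.tendsto
    simpa [Real.zero_rpow hα.ne'] using h
  exact squeeze_zero (fun _ => norm_nonneg _) (fun y => hA y x) hlim

/-- If `|f - g| ≤ K h` with `h` of finite integral on `(0,∞)`, the integrals of `f` and `g` over
`[0,t]` differ by at most `K ∫ h`, also when neither `f` nor `g` is integrable. -/
lemma abs_intervalIntegral_sub_le_mul_lintegral {f g h : ℝ → ℝ} {K t : ℝ} (hK : 0 ≤ K)
    (ht : 0 ≤ t) (hf : Measurable f) (hg : Measurable g) (hh : Measurable h)
    (h_nonneg : ∀ s, 0 ≤ h s) (hfg : ∀ s, |f s - g s| ≤ K * h s)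
    (hfin : ∫⁻ s in Set.Ioi (0 : ℝ), ENNReal.ofReal (h s) ≠ ⊤) :
    |(∫ s in (0 : ℝ)..t, f s) - ∫ s in (0 : ℝ)..t, g s| ≤
      K * (∫⁻ s in Set.Ioi (0 : ℝ), ENNReal.ofReal (h s)).toReal := by
  have hint : IntegrableOn h (Set.Ioi 0) := by
    refine ⟨hh.aestronglyMeasurable, ?_⟩
    rw [hasFiniteIntegral_iff_ofReal (Eventually.of_forall h_nonneg)]
    exact lt_top_iff_ne_top.2 hfin
  have htoReal : (∫⁻ s in Set.Ioi (0 : ℝ), ENNReal.ofReal (h s)).toReal =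
      ∫ s in Set.Ioi (0 : ℝ), h s :=
    (integral_eq_lintegral_of_nonneg_ae (Eventually.of_forall h_nonneg)
      hh.aestronglyMeasurable).symm
  have hdiff : IntegrableOn (fun s => f s - g s) (Set.Ioc 0 t) :=
    ((hint.mono_set Set.Ioc_subset_Ioi_self).const_mul K).mono'
      (hf.sub hg).aestronglyMeasurable (Eventually.of_forall hfg)
  rw [intervalIntegral.integral_of_le ht, intervalIntegral.integral_of_le ht, htoReal]
  by_cases hgi : IntegrableOn g (Set.Ioc 0 t)
  · have hfi : IntegrableOn f (Set.Ioc 0 t) := by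
      have h := hdiff.add hgi
      rwa [show (fun s => f s - g s) + g = f from funext fun s => sub_add_cancel _ _] at h
    rw [← integral_sub hfi hgi]
    calc |∫ s in Set.Ioc 0 t, f s - g s| ≤ ∫ s in Set.Ioc 0 t, |f s - g s| :=
          abs_integral_le_integral_abs
      _ ≤ ∫ s in Set.Ioc 0 t, K * h s :=
          integral_mono hdiff.abs ((hint.mono_set Set.Ioc_subset_Ioi_self).const_mul K) hfg
      _ = K * ∫ s in Set.Ioc 0 t, h s := integral_const_mul _ _
      _ ≤ K * ∫ s in Set.Ioi 0, h s :=
          mul_le_mul_of_nonneg_left (setIntegral_mono_set hint (Eventually.of_forall h_nonneg)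
            Set.Ioc_subset_Ioi_self.eventuallyLE) hK
  · have hfi : ¬ IntegrableOn f (Set.Ioc 0 t) := fun hfi => hgi (by
      have h := hfi.sub hdiff
      rwa [show (f - fun s => f s - g s) = g from funext fun s => sub_sub_cancel _ _] at h)
    rw [integral_undef hgi, integral_undef hfi, sub_self, abs_zero]
    exact mul_nonneg hK (setIntegral_nonneg measurableSet_Ioi fun s _ => h_nonneg s)

lemma coe_mul_log_le_coe_iff {s : ℝ} (hs : 0 < s) (p : ENNReal) (b : ℝ) :
    (s : EReal) * ENNReal.log p ≤ (b : EReal) ↔ p ≤ ENNReal.ofReal (Real.exp (b / s)) := by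
  rw [mul_comm, ← EReal.le_div_iff_mul_le (by exact_mod_cast hs) (EReal.coe_ne_top s),
    ← EReal.coe_div, ← EReal.exp_coe, ← ENNReal.log_le_log_iff, EReal.log_exp]

/-- The exponential Markov inequality for an extended nonnegative random variable. -/
lemma measure_ofReal_le_le_mul_exp_neg {Ω : Type*} [MeasurableSpace Ω] (P : Measure Ω)
    {Z : Ω → ENNReal} (hZ : Measurable Z) {δ : ℝ} (hδ : 0 < δ) {θ : ℝ} (hθ : 0 ≤ θ) :
    P {ω | ENNReal.ofReal θ ≤ Z ω} ≤
      (∫⁻ ω, EReal.exp ((δ : EReal) * (Z ω : EReal)) ∂P) *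
        ENNReal.ofReal (Real.exp (-(δ * θ))) := by
  have hmeas : Measurable fun ω => EReal.exp ((δ : EReal) * (Z ω : EReal)) := by
    have hmul : Measurable fun ω => (δ : EReal) * (Z ω : EReal) := by
      have h : ∀ ω, (δ : EReal) * (Z ω : EReal) =
          ((ENNReal.ofReal δ * Z ω : ENNReal) : EReal) := fun ω => by
        rw [EReal.coe_ennreal_mul, EReal.coe_ennreal_ofReal, max_eq_left hδ.le]
      simp_rw [h]
      exact measurable_coe_ennreal_ereal.comp (hZ.const_mul _)
    exact EReal.exp_monotone.measurable.comp hmul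
  have hpos : 0 < Real.exp (δ * θ) := Real.exp_pos _
  have hsub : {ω | ENNReal.ofReal θ ≤ Z ω} ⊆
      {ω | ENNReal.ofReal (Real.exp (δ * θ)) ≤ EReal.exp ((δ : EReal) * (Z ω : EReal))} := by
    intro ω hω
    have h1 : (θ : EReal) ≤ (Z ω : EReal) := by
      have h : ((ENNReal.ofReal θ : ENNReal) : EReal) ≤ (Z ω : EReal) := by exact_mod_cast hω
      rwa [EReal.coe_ennreal_ofReal, max_eq_left hθ] at h
    change ENNReal.ofReal (Real.exp (δ * θ)) ≤ _
    rw [← EReal.exp_coe, EReal.coe_mul]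
    exact EReal.exp_monotone (mul_le_mul_of_nonneg_left h1 (by exact_mod_cast hδ.le))
  calc P {ω | ENNReal.ofReal θ ≤ Z ω} ≤ _ := measure_mono hsub
    _ ≤ (∫⁻ ω, EReal.exp ((δ : EReal) * (Z ω : EReal)) ∂P) /
          ENNReal.ofReal (Real.exp (δ * θ)) :=
        meas_ge_le_lintegral_div hmeas.aemeasurable (by simpa using hpos) ENNReal.ofReal_ne_top
    _ = _ := by
        rw [Real.exp_neg, ENNReal.ofReal_inv_of_pos hpos, div_eq_mul_inv]

/-- Compactness of the sublevel sets of `I` keeps `I` above any level `c < inf_F I` on a closed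
thickening of `F`. -/
lemma exists_le_iInf_cthickening {I : ℝ → ENNReal}
    (hI : ∀ c : ENNReal, c ≠ ⊤ → IsCompact {y : ℝ | I y ≤ c}) {F : Set ℝ} (hF : IsClosed F)
    {c : ℝ} (hc : (c : EReal) < ⨅ y ∈ F, (I y : EReal)) :
    ∃ ε > 0, (c : EReal) ≤ ⨅ y ∈ Metric.cthickening ε F, (I y : EReal) := by
  rcases lt_or_ge c 0 with hc0 | hc0
  · refine ⟨1, one_pos, le_iInf₂ fun y _ => ?_⟩
    exact le_trans (by exact_mod_cast hc0.le) (EReal.coe_ennreal_nonneg _)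
  have hcoe : ((ENNReal.ofReal c : ENNReal) : EReal) = c := by
    rw [EReal.coe_ennreal_ofReal, max_eq_left hc0]
  have hdisj : Disjoint {y : ℝ | I y ≤ ENNReal.ofReal c} F := by
    refine Set.disjoint_left.2 fun y hy hyF => ?_
    have h1 : (I y : EReal) ≤ c := by
      rw [← hcoe]; exact_mod_cast hy
    exact absurd (hc.trans_le ((iInf₂_le y hyF).trans h1)) (lt_irrefl _)
  obtain ⟨ε, hε, hd⟩ := hdisj.exists_cthickenings (hI _ ENNReal.ofReal_ne_top) hF
  refine ⟨ε, hε, le_iInf₂ fun y hy => ?_⟩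
  have hy' : ¬ I y ≤ ENNReal.ofReal c := fun h =>
    Set.disjoint_left.1 hd (Metric.self_subset_cthickening _ h) hy
  rw [← hcoe]
  exact_mod_cast (not_le.1 hy').le

/-- Moderate deviation upper bounds are insensitive to adding an event whose probability is
`O(exp(-κ a(t)))` with `κ > 0`. -/
lemma ModerateScale.limsup_log_le_of_le_add_exp {a : ℝ → ℝ} (ha : ModerateScale a)
    {p q : ℝ → ENNReal} {C : ENNReal} (hC : C ≠ ⊤) {κ c : ℝ} (hκ : 0 < κ)
    (hq : limsup (fun t => ((t / (a t) ^ 2 : ℝ) : EReal) * ENNReal.log (q t)) atTop ≤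
      ((-c : ℝ) : EReal))
    (hp : ∀ t > 0, p t ≤ q t + C * ENNReal.ofReal (Real.exp (-(κ * a t)))) :
    limsup (fun t => ((t / (a t) ^ 2 : ℝ) : EReal) * ENNReal.log (p t)) atTop ≤
      ((-c : ℝ) : EReal) := by
  obtain ⟨hpos, hsqrt, hdiv⟩ := ha
  have hs0 : Tendsto (fun t => t / (a t) ^ 2) atTop (𝓝 0) := by
    have h := hsqrt.pow 2
    rw [zero_pow two_ne_zero] at h
    refine h.congr' ?_
    filter_upwards [eventually_gt_atTop (0 : ℝ)] with t ht
    rw [div_pow, Real.sq_sqrt ht.le]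
  have hinf : Tendsto (fun t => t / a t) atTop atTop := by
    have h : Tendsto (fun t => a t / t) atTop (𝓝[>] 0) :=
      tendsto_nhdsWithin_iff.2 ⟨hdiv, by
        filter_upwards [eventually_gt_atTop (0 : ℝ)] with t ht
        exact div_pos (hpos t ht) ht⟩
    refine h.inv_tendsto_nhdsGT_zero.congr fun t => ?_
    simp
  refine EReal.le_of_forall_lt_iff_le.1 fun b hb => ?_
  have hbc : -c < b := by exact_mod_cast hb
  obtain ⟨b', hcb', hb'b⟩ := exists_between hbc
  have hq' := eventually_lt_of_limsup_lt (hq.trans_lt (EReal.coe_lt_coe_iff.2 hcb'))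
  have hlog2 : ∀ᶠ t in atTop, t / (a t) ^ 2 * Real.log 2 < b - b' := by
    have h := hs0.mul_const (Real.log 2)
    rw [zero_mul] at h
    exact h.eventually_lt_const (by linarith)
  have hlogC : ∀ᶠ t in atTop, t / (a t) ^ 2 * Real.log (C.toReal + 1) < 1 := by
    have h := hs0.mul_const (Real.log (C.toReal + 1))
    rw [zero_mul] at h
    exact h.eventually_lt_const one_pos
  have hbig := hinf.eventually_ge_atTop ((1 - b') / κ)
  refine limsup_le_of_le (by isBoundedDefault) ?_
  filter_upwards [hq', hlog2, hlogC, hbig, eventually_gt_atTop (0 : ℝ)] with t h1 h2 h3 h4 ht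
  have hat := hpos t ht
  have hs : 0 < t / (a t) ^ 2 := by positivity
  have hsa : t / (a t) ^ 2 * (κ * a t) = κ * (t / a t) := by field_simp
  set s := t / (a t) ^ 2
  rw [coe_mul_log_le_coe_iff hs]
  have hq1 := (coe_mul_log_le_coe_iff hs _ _).1 h1.le
  have hC1 : 0 < C.toReal + 1 := by positivity
  have hC2 : C * ENNReal.ofReal (Real.exp (-(κ * a t))) ≤ ENNReal.ofReal (Real.exp (b' / s)) := by
    have hCle : C ≤ ENNReal.ofReal (Real.exp (Real.log (C.toReal + 1))) := by
      rw [Real.exp_log hC1]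
      exact ENNReal.le_ofReal_iff_toReal_le hC hC1.le |>.2 (by linarith)
    refine (mul_le_mul_left hCle _).trans ?_
    rw [← ENNReal.ofReal_mul (Real.exp_pos _).le, ← Real.exp_add]
    refine ENNReal.ofReal_le_ofReal (Real.exp_le_exp.2 ?_)
    rw [le_div_iff₀ hs]
    have h5 : 1 - b' ≤ κ * (t / a t) := by
      rw [div_le_iff₀ hκ] at h4
      linarith
    linarith
  calc p t ≤ _ := hp t ht
    _ ≤ ENNReal.ofReal (Real.exp (b' / s)) + ENNReal.ofReal (Real.exp (b' / s)) :=
        add_le_add hq1 hC2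
    _ = ENNReal.ofReal (Real.exp (Real.log 2 + b' / s)) := by
        rw [← ENNReal.ofReal_add (Real.exp_pos _).le (Real.exp_pos _).le, Real.exp_add,
          Real.exp_log two_pos, two_mul]
    _ ≤ ENNReal.ofReal (Real.exp (b / s)) := by
        refine ENNReal.ofReal_le_ofReal (Real.exp_le_exp.2 ?_)
        rw [le_div_iff₀ hs, add_mul, div_mul_cancel₀ _ hs.ne']
        linarith

theorem stmt_4
    {Ω : Type*} [MeasurableSpace Ω] (P : Measure Ω) [IsProbabilityMeasure P]
    (d : ℕ)
    (X Xbar : ℝ → Ω → EuclideanSpace ℝ (Fin d))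
    (hX : Measurable (Function.uncurry X)) (hXbar : Measurable (Function.uncurry Xbar))
    (α : ℝ) (hα : α ∈ Set.Ioo (0 : ℝ) 1) (K : ℝ) (hK : 0 ≤ K)
    (A : EuclideanSpace ℝ (Fin d) → ℝ)
    (hA : ∀ x y : EuclideanSpace ℝ (Fin d),
      |A x - A y| ≤ K * ‖x - y‖ ^ α * (1 + ‖x‖ + ‖y‖) ^ (2 - α))
    (m : ℝ)
    (I : ℝ → ENNReal) (hI_lsc : LowerSemicontinuous I)
    (hI_good : ∀ c : ENNReal, c ≠ ⊤ → IsCompact {y : ℝ | I y ≤ c})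
    (hupper : ∀ a : ℝ → ℝ, ModerateScale a → ∀ F : Set ℝ, IsClosed F →
      Filter.limsup
        (fun t => ((t / (a t) ^ 2 : ℝ) : EReal) *
          ENNReal.log (P {ω | ((1 / a t) * ∫ s in (0 : ℝ)..t, (A (Xbar s ω) - m)) ∈ F}))
        atTop ≤ -(⨅ y ∈ F, (I y : EReal)))
    (hexp : ∃ δ > (0 : ℝ),
      (∫⁻ ω, EReal.exp ((δ : EReal) *
          ((∫⁻ s in Set.Ioi (0 : ℝ),
            ENNReal.ofReal (‖X s ω - Xbar s ω‖ ^ α *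
              (1 + ‖X s ω‖ + ‖Xbar s ω‖) ^ (2 - α))) : EReal)) ∂P) < ⊤) :
    ∀ a : ℝ → ℝ, ModerateScale a → ∀ F : Set ℝ, IsClosed F →
      Filter.limsup
        (fun t => ((t / (a t) ^ 2 : ℝ) : EReal) *
          ENNReal.log (P {ω | ((1 / a t) * ∫ s in (0 : ℝ)..t, (A (X s ω) - m)) ∈ F}))
        atTop ≤ -(⨅ y ∈ F, (I y : EReal)) := by
  intro a ha F hF
  obtain ⟨δ, hδ, hfin⟩ := hexp
  set Z : Ω → ENNReal := fun ω => ∫⁻ s in Set.Ioi (0 : ℝ),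
    ENNReal.ofReal (‖X s ω - Xbar s ω‖ ^ α * (1 + ‖X s ω‖ + ‖Xbar s ω‖) ^ (2 - α)) with hZ_def
  have hAm : Measurable A := (continuous_of_abs_sub_le_rpow hα.1 hA).measurable
  have hXs : Measurable fun z : Ω × ℝ => X z.2 z.1 := hX.comp measurable_swap
  have hXbars : Measurable fun z : Ω × ℝ => Xbar z.2 z.1 := hXbar.comp measurable_swap
  have hh : Measurable fun z : Ω × ℝ => ‖X z.2 z.1 - Xbar z.2 z.1‖ ^ α *
      (1 + ‖X z.2 z.1‖ + ‖Xbar z.2 z.1‖) ^ (2 - α) := by fun_prop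
  have hZ : Measurable Z := hh.ennreal_ofReal.lintegral_prod_right'
  rw [EReal.le_neg]
  refine EReal.ge_of_forall_gt_iff_ge.1 fun c hc => ?_
  rw [EReal.le_neg, ← EReal.coe_neg]
  obtain ⟨ε, hε, hcε⟩ := exists_le_iInf_cthickening hI_good hF hc
  have hK1 : 0 < K + 1 := by linarith
  refine ha.limsup_log_le_of_le_add_exp (C := ∫⁻ ω, EReal.exp ((δ : EReal) * (Z ω : EReal)) ∂P)
    (κ := δ * (ε / (K + 1))) hfin.ne (by positivity)
    ((hupper a ha _ Metric.isClosed_cthickening).trans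
      (by rw [EReal.coe_neg]; exact EReal.neg_le_neg_iff.2 hcε)) fun t ht => ?_
  have hat : 0 < a t := ha.1 t ht
  have hsub : {ω | ((1 / a t) * ∫ s in (0 : ℝ)..t, (A (X s ω) - m)) ∈ F} ⊆
      {ω | ((1 / a t) * ∫ s in (0 : ℝ)..t, (A (Xbar s ω) - m)) ∈ Metric.cthickening ε F} ∪
        {ω | ENNReal.ofReal (ε / (K + 1) * a t) ≤ Z ω} := by
    intro ω hω
    by_contra hcon
    rw [Set.mem_union, not_or] at hcon
    obtain ⟨hbar, hZω⟩ := hcon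
    have hZlt : Z ω < ENNReal.ofReal (ε / (K + 1) * a t) := not_le.1 hZω
    have hZtop : Z ω ≠ ⊤ := hZlt.ne_top
    have hZr : (Z ω).toReal < ε / (K + 1) * a t :=
      (ENNReal.lt_ofReal_iff_toReal_lt hZtop).1 hZlt
    have hXω : Measurable fun s => X s ω := hX.comp measurable_prodMk_right
    have hXbarω : Measurable fun s => Xbar s ω := hXbar.comp measurable_prodMk_right
    have hdiff := abs_intervalIntegral_sub_le_mul_lintegral (K := K + 1) (t := t)
      (f := fun s => A (X s ω) - m) (g := fun s => A (Xbar s ω) - m)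
      (h := fun s => ‖X s ω - Xbar s ω‖ ^ α * (1 + ‖X s ω‖ + ‖Xbar s ω‖) ^ (2 - α))
      hK1.le ht.le ((hAm.comp hXω).sub_const m) ((hAm.comp hXbarω).sub_const m)
      (by fun_prop) (fun s => by positivity)
      (fun s => by
        have h1 := hA (X s ω) (Xbar s ω)
        have h2 : 0 ≤ ‖X s ω - Xbar s ω‖ ^ α * (1 + ‖X s ω‖ + ‖Xbar s ω‖) ^ (2 - α) := by
          positivity
        rw [sub_sub_sub_cancel_right]
        linarith) hZtop
    refine hbar (Metric.mem_cthickening_of_dist_le _ _ ε F hω ?_)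
    rw [dist_comm, Real.dist_eq, ← mul_sub, abs_mul, abs_of_pos (by positivity : 0 < 1 / a t),
      one_div, inv_mul_le_iff₀ hat]
    calc _ ≤ (K + 1) * (Z ω).toReal := hdiff
      _ ≤ (K + 1) * (ε / (K + 1) * a t) := mul_le_mul_of_nonneg_left hZr.le hK1.le
      _ = a t * ε := by field_simp
  refine (measure_mono hsub).trans ((measure_union_le _ _).trans (add_le_add le_rfl ?_))
  have hmarkov := measure_ofReal_le_le_mul_exp_neg P hZ hδ
    (θ := ε / (K + 1) * a t) (by positivity)
  rwa [← mul_assoc] at hmarkov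
end

section
/- Let d ∈ ℕ, λ > 0, p > 1, K ≥ 0, β > 0 and α ≥ 0. Let A : ℝ^d → ℝ satisfy |A(x) − A(y)| ≤ K · (1 + |x|² + |y|²) / ( log(e + |x|² + |y|²) · [log(e + |x − y|^{−1})]^p ) for all x ≠ y in ℝ^d. Let x, x̄ : [0,∞) → ℝ^d be measurable paths such that for every t ≥ 0, |x_t − x̄_t| ≤ β e^{−λ t} and |x_t|² + |x̄_t|² ≤ α. Then ∫₀^∞ |A(x_t) − A(x̄_t)| dt ≤ (K/λ) · [ (1 + e)(e + α)/(p − 1) + e + α + β ]. -/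
open MeasureTheory
open scoped Classical

/-- `Φ(x, y) = (1 + |x|² + |y|²) / (log(e + |x|² + |y|²) · [log(e + |x − y|⁻¹)]^p)` for
`x ≠ y`, and `Φ(x, x) = 0`. -/
noncomputable def PhiAux {d : ℕ} (p : ℝ) (x y : EuclideanSpace ℝ (Fin d)) : ℝ :=
  if x = y then 0
  else (1 + ‖x‖ ^ 2 + ‖y‖ ^ 2) /
    (Real.log (Real.exp 1 + ‖x‖ ^ 2 + ‖y‖ ^ 2) *
      Real.log (Real.exp 1 + ‖x - y‖⁻¹) ^ p)

lemma one_add_div_le_log_exp_one_add_exp (v : ℝ) :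
    1 + v / (1 + Real.exp 1) ≤ Real.log (Real.exp 1 + Real.exp v) := by
  have he := Real.exp_pos 1
  rw [Real.le_log_iff_exp_le (by positivity), Real.exp_add]
  set m := v / (1 + Real.exp 1) with hm
  have hv : v = m * (1 + Real.exp 1) := by rw [hm]; field_simp
  have h1 := Real.add_one_le_exp (-m)
  have h2 := Real.add_one_le_exp (v - m)
  have h3 : Real.exp 1 ≤ Real.exp 1 * Real.exp (-m) + Real.exp (v - m) := by
    nlinarith [mul_le_mul_of_nonneg_left h1 he.le]
  calc Real.exp 1 * Real.exp m
      ≤ (Real.exp 1 * Real.exp (-m) + Real.exp (v - m)) * Real.exp m := by gcongr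
    _ = Real.exp 1 + Real.exp v := by
      rw [add_mul, mul_assoc, ← Real.exp_add, ← Real.exp_add, neg_add_cancel, add_zero,
        ← Real.exp_add, sub_add_cancel]

lemma mul_log_le_max_mul_log {a b : ℝ} (ha : Real.exp 1 ≤ a) (hb : 0 < b) :
    a * Real.log b ≤ max a b * Real.log a := by
  have ha0 : 0 < a := (Real.exp_pos 1).trans_le ha
  rcases le_total b a with h | h
  · rw [max_eq_left h]
    gcongr
  · rw [max_eq_right h]
    have := Real.log_div_self_antitoneOn (a := a) ha (b := b) (ha.trans h) h
    rw [div_le_div_iff₀ hb ha0] at this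
    linarith

lemma lintegral_Ioi_one_add_mul_sub_rpow_neg {c p : ℝ} (hc : 0 < c) (hp : 1 < p) (T : ℝ) :
    ∫⁻ t in Set.Ioi T, ENNReal.ofReal ((1 + c * (t - T)) ^ (-p)) =
      ENNReal.ofReal (1 / (c * (p - 1))) := by
  have hp1 : 0 < p - 1 := by linarith
  have hpos : ∀ t ∈ Set.Ici T, 0 < 1 + c * (t - T) := fun t ht => by
    have : 0 ≤ c * (t - T) := mul_nonneg hc.le (sub_nonneg.2 ht)
    linarith
  have hderiv : ∀ t ∈ Set.Ici T, HasDerivAt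
      (fun t => -(1 + c * (t - T)) ^ (1 - p) / (c * (p - 1))) ((1 + c * (t - T)) ^ (-p)) t := by
    intro t ht
    have h1 : HasDerivAt (fun t => 1 + c * (t - T)) c t := by
      simpa using (((hasDerivAt_id t).sub_const T).const_mul c).const_add 1
    refine ((h1.rpow_const (p := 1 - p) (Or.inl (hpos t ht).ne')).neg.div_const
      (c * (p - 1))).congr_deriv ?_
    rw [show 1 - p - 1 = -p by ring]
    field_simp
    ring
  have hnonneg : ∀ t ∈ Set.Ioi T, 0 ≤ (1 + c * (t - T)) ^ (-p) := fun t ht =>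
    Real.rpow_nonneg (hpos t (Set.Ioi_subset_Ici_self ht)).le _
  have hlin : Filter.Tendsto (fun t => 1 + c * (t - T)) Filter.atTop Filter.atTop :=
    Filter.tendsto_atTop_add_const_left _ _
      ((Filter.tendsto_atTop_add_const_right _ _ Filter.tendsto_id).const_mul_atTop hc)
  have hlim : Filter.Tendsto (fun t => -(1 + c * (t - T)) ^ (1 - p) / (c * (p - 1)))
      Filter.atTop (nhds 0) := by
    have := (((tendsto_rpow_neg_atTop hp1).comp hlin).neg).div_const (c * (p - 1))
    simpa [Function.comp_def] using this
  rw [← ofReal_integral_eq_lintegral_ofReal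
    (integrableOn_Ioi_deriv_of_nonneg' hderiv hnonneg hlim)
    ((ae_restrict_iff' measurableSet_Ioi).2 (Filter.Eventually.of_forall hnonneg)),
    integral_Ioi_of_hasDerivAt_of_nonneg' hderiv hnonneg hlim]
  congr 1
  rw [sub_self, mul_zero, add_zero, Real.one_rpow, neg_div, sub_neg_eq_add, zero_add]

section PhiAux

variable {d : ℕ} {p : ℝ} {x y : EuclideanSpace ℝ (Fin d)}

lemma PhiAux_le_div_mul (hxy : x ≠ y) {w : ℝ} (hw : 0 < w) (hp : 0 ≤ p)
    (hwle : w ≤ Real.log (Real.exp 1 + ‖x - y‖⁻¹)) :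
    PhiAux p x y ≤ (Real.exp 1 + (‖x‖ ^ 2 + ‖y‖ ^ 2)) /
      Real.log (Real.exp 1 + (‖x‖ ^ 2 + ‖y‖ ^ 2)) * w ^ (-p) := by
  have he : 1 ≤ Real.exp 1 := Real.one_le_exp zero_le_one
  have hlog : 0 < Real.log (Real.exp 1 + (‖x‖ ^ 2 + ‖y‖ ^ 2)) :=
    Real.log_pos (by linarith [Real.exp_one_gt_d9, sq_nonneg ‖x‖, sq_nonneg ‖y‖])
  rw [PhiAux, if_neg hxy, Real.rpow_neg hw.le, ← div_eq_mul_inv, div_div,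
    add_assoc (Real.exp 1), add_assoc (1 : ℝ)]
  gcongr

lemma PhiAux_le_mul_rpow_neg (hxy : x ≠ y) {w : ℝ} (hw : 0 < w) (hp : 0 ≤ p)
    (hwle : w ≤ Real.log (Real.exp 1 + ‖x - y‖⁻¹)) {α : ℝ} (hα : ‖x‖ ^ 2 + ‖y‖ ^ 2 ≤ α) :
    PhiAux p x y ≤ (Real.exp 1 + α) * w ^ (-p) := by
  refine (PhiAux_le_div_mul hxy hw hp hwle).trans ?_
  have hs : 0 ≤ ‖x‖ ^ 2 + ‖y‖ ^ 2 := by positivity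
  have he := Real.exp_pos 1
  gcongr
  refine (div_le_self (by linarith) ?_).trans (by linarith)
  rw [Real.le_log_iff_exp_le (by linarith)]
  linarith

lemma PhiAux_le_div_log (hxy : x ≠ y) (hp : 0 ≤ p) {α β : ℝ} (hα : ‖x‖ ^ 2 + ‖y‖ ^ 2 ≤ α)
    (hβ : 1 < β) : PhiAux p x y ≤ (Real.exp 1 + α + β) / Real.log β := by
  have hs : 0 ≤ ‖x‖ ^ 2 + ‖y‖ ^ 2 := by positivity
  have he := Real.exp_pos 1
  have hinv : 0 ≤ ‖x - y‖⁻¹ := by positivity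
  have h1 : 1 ≤ Real.log (Real.exp 1 + ‖x - y‖⁻¹) := by
    rw [Real.le_log_iff_exp_le (by linarith)]
    linarith
  have h2 : 1 ≤ Real.log (Real.exp 1 + (‖x‖ ^ 2 + ‖y‖ ^ 2)) := by
    rw [Real.le_log_iff_exp_le (by linarith)]
    linarith
  refine (PhiAux_le_div_mul hxy one_pos hp h1).trans ?_
  rw [Real.one_rpow, mul_one, div_le_div_iff₀ (by linarith) (Real.log_pos hβ)]
  refine (mul_log_le_max_mul_log (by linarith) (by linarith)).trans ?_
  gcongr
  exact max_le (by linarith) (by linarith)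

end PhiAux

theorem stmt_12
    (d : ℕ) (lam p K β α : ℝ)
    (hlam : 0 < lam) (hp : 1 < p) (hK : 0 ≤ K) (hβ : 0 < β) (hα : 0 ≤ α)
    (A : EuclideanSpace ℝ (Fin d) → ℝ)
    (hA : ∀ x y : EuclideanSpace ℝ (Fin d), x ≠ y → |A x - A y| ≤ K * PhiAux p x y)
    (x xbar : ℝ → EuclideanSpace ℝ (Fin d))
    (hx : Measurable x) (hxbar : Measurable xbar)
    (hclose : ∀ t : ℝ, 0 ≤ t → ‖x t - xbar t‖ ≤ β * Real.exp (-lam * t))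
    (hbdd : ∀ t : ℝ, 0 ≤ t → ‖x t‖ ^ 2 + ‖xbar t‖ ^ 2 ≤ α) :
    (∫⁻ t in Set.Ioi (0 : ℝ), ENNReal.ofReal |A (x t) - A (xbar t)|) ≤
      ENNReal.ofReal ((K / lam) *
        ((1 + Real.exp 1) * (Real.exp 1 + α) / (p - 1) + Real.exp 1 + α + β)) := by
  have he := Real.exp_pos 1
  set T : ℝ := max 0 (Real.log β) / lam with hT
  set c : ℝ := lam / (1 + Real.exp 1) with hc_def
  have hc : 0 < c := by positivity
  have hT0 : 0 ≤ T := by positivity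
  have hlamT : lam * T = max 0 (Real.log β) := by rw [hT]; field_simp
  have hβT : β ≤ Real.exp (lam * T) := by
    rw [hlamT, ← Real.log_le_iff_le_exp hβ]
    exact le_max_right _ _
  have hp1 : 0 < p - 1 := by linarith
  have hpos : 0 < Real.exp 1 + α + β := by positivity
  have hfirst : ∫⁻ t in Set.Ioc 0 T, ENNReal.ofReal |A (x t) - A (xbar t)| ≤
      ENNReal.ofReal (K / lam * (Real.exp 1 + α + β)) := by
    rcases le_or_gt β 1 with hβ1 | hβ1
    · have : T = 0 := by rw [hT, max_eq_left (Real.log_nonpos hβ.le hβ1), zero_div]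
      simp [this]
    · have hlog := Real.log_pos hβ1
      calc ∫⁻ t in Set.Ioc 0 T, ENNReal.ofReal |A (x t) - A (xbar t)|
          ≤ ∫⁻ _ in Set.Ioc 0 T,
              ENNReal.ofReal (K * ((Real.exp 1 + α + β) / Real.log β)) := by
            refine setLIntegral_mono' measurableSet_Ioc fun t ht =>
              ENNReal.ofReal_le_ofReal ?_
            by_cases hxy : x t = xbar t
            · rw [hxy, sub_self, abs_zero]
              positivity
            · refine (hA _ _ hxy).trans (mul_le_mul_of_nonneg_left ?_ hK)
              exact PhiAux_le_div_log hxy (by linarith) (hbdd t ht.1.le) hβ1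
        _ = ENNReal.ofReal (K / lam * (Real.exp 1 + α + β)) := by
            rw [setLIntegral_const, Real.volume_Ioc, ← ENNReal.ofReal_mul (by positivity)]
            congr 1
            rw [hT, max_eq_right hlog.le]
            field_simp
            ring
  have hsecond : ∫⁻ t in Set.Ioi T, ENNReal.ofReal |A (x t) - A (xbar t)| ≤
      ENNReal.ofReal (K / lam * ((1 + Real.exp 1) * (Real.exp 1 + α) / (p - 1))) := by
    calc ∫⁻ t in Set.Ioi T, ENNReal.ofReal |A (x t) - A (xbar t)|
        ≤ ∫⁻ t in Set.Ioi T, ENNReal.ofReal (K * (Real.exp 1 + α)) *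
            ENNReal.ofReal ((1 + c * (t - T)) ^ (-p)) := by
          refine setLIntegral_mono' measurableSet_Ioi fun t ht => ?_
          have ht' : T < t := ht
          have hw : 0 < 1 + c * (t - T) := by
            have := mul_pos hc (sub_pos.2 ht')
            linarith
          rw [← ENNReal.ofReal_mul (by positivity)]
          refine ENNReal.ofReal_le_ofReal ?_
          by_cases hxy : x t = xbar t
          · rw [hxy, sub_self, abs_zero]
            positivity
          · have ht0 : 0 ≤ t := hT0.trans ht'.le
            rw [mul_assoc]
            refine (hA _ _ hxy).trans (mul_le_mul_of_nonneg_left ?_ hK)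
            refine PhiAux_le_mul_rpow_neg hxy hw (by linarith) ?_ (hbdd t ht0)
            have hnorm : 0 < ‖x t - xbar t‖ := norm_pos_iff.2 (sub_ne_zero.2 hxy)
            have hexp : Real.exp (lam * (t - T)) ≤ ‖x t - xbar t‖⁻¹ := by
              rw [le_inv_comm₀ (Real.exp_pos _) hnorm, ← Real.exp_neg]
              calc ‖x t - xbar t‖ ≤ β * Real.exp (-lam * t) := hclose t ht0
                _ ≤ Real.exp (lam * T) * Real.exp (-lam * t) := by gcongr
                _ = Real.exp (-(lam * (t - T))) := by rw [← Real.exp_add]; ring_nf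
            calc 1 + c * (t - T) = 1 + lam * (t - T) / (1 + Real.exp 1) := by
                  rw [hc_def]; ring
              _ ≤ Real.log (Real.exp 1 + Real.exp (lam * (t - T))) :=
                  one_add_div_le_log_exp_one_add_exp _
              _ ≤ Real.log (Real.exp 1 + ‖x t - xbar t‖⁻¹) := by gcongr
      _ = ENNReal.ofReal (K / lam * ((1 + Real.exp 1) * (Real.exp 1 + α) / (p - 1))) := by
          rw [lintegral_const_mul' _ _ ENNReal.ofReal_ne_top,
            lintegral_Ioi_one_add_mul_sub_rpow_neg hc hp T,
            ← ENNReal.ofReal_mul (by positivity)]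
          congr 1
          rw [hc_def]
          field_simp
  rw [← Set.Ioc_union_Ioi_eq_Ioi hT0]
  refine (lintegral_union_le _ _ _).trans ((add_le_add hfirst hsecond).trans_eq ?_)
  rw [← ENNReal.ofReal_add (by positivity) (by positivity)]
  congr 1
  ring
end
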